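/- arXiv:2401.11962 — 3 statements merged into one kernel-verified Lean document; each statement's English description precedes it below -/
import Mathlib

section
/- There exists a universal constant C > 0 with the following property. Let H, L, R, T > 0 and 0 < α ≤ 1 satisfy H·R² ≤ π²/4. For i = 1, 2 let K_i : (0, R] → ℝ be continuous functions with ‖K_i‖_∞ ≤ H and ‖K_i‖_α ≤ L, and suppose ‖K₁ − K₂‖_∞ ≤ T. Let h_i : (0, R] → ℝ be differentiable solutions of the Riccati equation h_i′(x) + h_i(x)² + K_i(x) = 0 satisfying h_i(x) = 1/x + O(x) as x → 0⁺. Then the function f := h₁ − h₂ satisfies, for every 0 < r ≤ R, on the interval [r, R]: (a) ‖f‖_∞ ≤ C·T·R; (b) ‖f′‖_∞ ≤ C·T; (c) ‖f‖_α ≤ C·T·R^{1−α}; (d) ‖f′‖_α ≤ C·(L + T·R^{−α}·(1 + R/r)). -/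
open Set

lemma ric_barrier {R M δ : ℝ} {p w w' : ℝ → ℝ} (hδ : 0 < δ) (hM : 0 < M)
    (hp : ContinuousOn p (Ioc 0 R))
    (hw : ∀ x ∈ Ioc (0:ℝ) R, HasDerivWithinAt w (w' x) (Ioc 0 R) x)
    (hin : ∀ x ∈ Ioc (0:ℝ) R, 0 ≤ w' x + p x * w x)
    (hp0 : ∀ x ∈ Ioc (0:ℝ) R, x ≤ δ → 0 ≤ p x)
    (hw0 : ∀ x ∈ Ioc (0:ℝ) R, x ≤ δ → -(M * x) ≤ w x) :
    ∀ x ∈ Ioc (0:ℝ) R, 0 ≤ w x := by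
  intro x hx
  have hR : 0 < R := hx.1.trans_le hx.2
  set q : ℝ → ℝ := fun t => p (min t R) with hq
  have hqc : ContinuousOn q (Ioi 0) := by
    apply hp.comp (by fun_prop)
    intro t ht
    exact ⟨lt_min ht hR, min_le_right _ _⟩
  set P : ℝ → ℝ := fun t => ∫ u in R..t, q u with hP
  have hPd : ∀ t, 0 < t → HasDerivAt P (q t) t := by
    intro t ht
    apply intervalIntegral.integral_hasDerivAt_right
    · apply ContinuousOn.intervalIntegrable
      apply hqc.mono
      intro u hu
      rw [mem_uIcc] at hu
      rcases hu with h | h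
      · exact hR.trans_le h.1
      · exact ht.trans_le h.1
    · exact hqc.stronglyMeasurableAtFilter isOpen_Ioi t ht
    · exact hqc.continuousAt (Ioi_mem_nhds ht)
  have hPd' : ∀ t ∈ Ioc (0:ℝ) R, HasDerivAt P (p t) t := by
    intro t ht
    have := hPd t ht.1
    simpa [hq, min_eq_left ht.2] using this
  have hPc : ContinuousOn P (Ioc 0 R) := fun t ht => (hPd' t ht).continuousAt.continuousWithinAt
  have hG : ∀ t ∈ Ioc (0:ℝ) R, HasDerivWithinAt (fun t => Real.exp (P t) * w t)
      (Real.exp (P t) * (w' t + p t * w t)) (Ioc 0 R) t := by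
    intro t ht
    have := ((hPd' t ht).exp.hasDerivWithinAt (s := Ioc 0 R)).mul (hw t ht)
    refine this.congr_deriv ?_
    ring
  have hmono : MonotoneOn (fun t => Real.exp (P t) * w t) (Ioc 0 R) := by
    apply monotoneOn_of_hasDerivWithinAt_nonneg (convex_Ioc 0 R)
      (f' := fun t => Real.exp (P t) * (w' t + p t * w t))
    · exact fun t ht => (hG t ht).continuousWithinAt
    · intro t ht
      exact (hG t (interior_subset ht)).mono interior_subset
    · intro t ht
      exact mul_nonneg (Real.exp_pos _).le (hin t (interior_subset ht))
  set d := min δ x with hd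
  have hd0 : 0 < d := lt_min hδ hx.1
  have hdR : d ≤ R := (min_le_right _ _).trans hx.2
  have hPm : MonotoneOn P (Ioc 0 d) := by
    apply monotoneOn_of_hasDerivWithinAt_nonneg (convex_Ioc 0 d) (f' := p)
    · exact hPc.mono (Ioc_subset_Ioc_right hdR)
    · intro t ht
      have ht := interior_subset ht
      exact (hPd' t ⟨ht.1, ht.2.trans hdR⟩).hasDerivWithinAt
    · intro t ht
      have ht := interior_subset ht
      exact hp0 t ⟨ht.1, ht.2.trans hdR⟩ (ht.2.trans (min_le_left _ _))
  by_contra hneg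
  push Not at hneg
  have hE : 0 < Real.exp (P x) * (- w x) := mul_pos (Real.exp_pos _) (by linarith)
  set E := Real.exp (P x) * (- w x) with hEdef
  have hA : 0 < Real.exp (P d) * M := mul_pos (Real.exp_pos _) hM
  set A := Real.exp (P d) * M with hAdef
  set t := min d (E / (2 * A)) with htdef
  have ht0 : 0 < t := lt_min hd0 (by positivity)
  have htd : t ≤ d := min_le_left _ _
  have htE : t ≤ E / (2 * A) := min_le_right _ _
  have htR : t ∈ Ioc 0 R := ⟨ht0, htd.trans hdR⟩
  have h1 := hmono htR hx (htd.trans (min_le_right _ _))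
  simp only at h1
  have h2 := hw0 t htR (htd.trans (min_le_left _ _))
  have h3 : Real.exp (P t) ≤ Real.exp (P d) :=
    Real.exp_le_exp.2 (hPm ⟨ht0, htd⟩ ⟨hd0, le_rfl⟩ htd)
  have h4 : Real.exp (P t) * (-(M * t)) ≤ Real.exp (P t) * w t :=
    mul_le_mul_of_nonneg_left h2 (Real.exp_pos _).le
  have h5 : Real.exp (P t) * (M * t) ≤ Real.exp (P d) * (M * t) :=
    mul_le_mul_of_nonneg_right h3 (by positivity)
  have h6 : A * t ≤ E / 2 := by
    rw [le_div_iff₀ (by positivity)] at htE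
    linarith
  have h7 : Real.exp (P d) * (M * t) = A * t := by rw [hAdef]; ring
  have h8 : Real.exp (P x) * w x = -E := by rw [hEdef]; ring
  linarith

lemma ric_pos {H R : ℝ} {K h h' : ℝ → ℝ} (hH : 0 < H) (hHR : H * R ^ 2 ≤ Real.pi ^ 2 / 4)
    (hK : ∀ x ∈ Ioc (0:ℝ) R, |K x| ≤ H)
    (hd : ∀ x ∈ Ioc (0:ℝ) R, HasDerivWithinAt h (h' x) (Ioc 0 R) x)
    (he : ∀ x ∈ Ioc (0:ℝ) R, h' x + h x ^ 2 + K x = 0)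
    (h0 : ∃ M δ : ℝ, 0 < M ∧ 0 < δ ∧ ∀ x : ℝ, 0 < x → x ≤ δ → |h x - 1 / x| ≤ M * x) :
    ∀ x ∈ Ioc (0:ℝ) R, 0 ≤ h x := by
  obtain ⟨M, δ, hM, hδ, h0⟩ := h0
  set s := Real.sqrt H with hs
  have hs0 : 0 < s := Real.sqrt_pos.2 hH
  have hsH : s ^ 2 = H := Real.sq_sqrt hH.le
  have hsx : ∀ x ∈ Ioc (0:ℝ) R, s * x ≤ Real.pi / 2 := by
    intro x hx
    have hR : 0 < R := hx.1.trans_le hx.2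
    have : (s * R) ^ 2 ≤ (Real.pi / 2) ^ 2 := by rw [mul_pow, hsH]; linarith
    have := (abs_le_of_sq_le_sq' this (by positivity)).2
    exact (mul_le_mul_of_nonneg_left hx.2 hs0.le).trans this
  have hsin : ∀ x ∈ Ioc (0:ℝ) R, 0 < Real.sin (s * x) := fun x hx =>
    Real.sin_pos_of_pos_of_lt_pi (mul_pos hs0 hx.1) (by linarith [hsx x hx, Real.pi_pos])
  have hcos : ∀ x ∈ Ioc (0:ℝ) R, 0 ≤ Real.cos (s * x) := fun x hx =>
    Real.cos_nonneg_of_neg_pi_div_two_le_of_le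
      (by linarith [mul_pos hs0 hx.1, Real.pi_pos]) (hsx x hx)
  have key : ∀ x ∈ Ioc (0:ℝ) R, 0 ≤ h x * Real.sin (s * x) - s * Real.cos (s * x) := by
    apply ric_barrier (M := M + s ^ 2) (δ := min (min δ 1) (min (1 / s) (1 / (M + 1)))) (p := h)
      (w' := fun x => h' x * Real.sin (s * x) + h x * (Real.cos (s * x) * s)
        - s * (-Real.sin (s * x) * s))
    · positivity
    · positivity
    · exact fun x hx => (hd x hx).continuousWithinAt
    · intro x hx
      have e : HasDerivAt (fun x : ℝ => s * x) s x := by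
        simpa using (hasDerivAt_id x).const_mul s
      exact ((hd x hx).mul e.sin.hasDerivWithinAt).sub ((e.cos.hasDerivWithinAt).const_mul s)
    · intro x hx
      have e1 : h' x = - h x ^ 2 - K x := by linarith [he x hx]
      have e2 := (abs_le.1 (hK x hx)).2
      have e3 : 0 ≤ (H - K x) * Real.sin (s * x) := mul_nonneg (by linarith) (hsin x hx).le
      rw [e1]
      rw [← hsH] at e3
      linarith
    · intro x hx hxd
      have hx0 := hx.1
      simp only [le_min_iff] at hxd
      obtain ⟨⟨a1, a2⟩, a3, a4⟩ := hxd
      have b := (abs_le.1 (h0 x hx0 a1)).1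
      rw [le_div_iff₀ (by positivity)] at a4
      have : M * x ≤ 1 / x := by
        rw [le_div_iff₀ hx0]
        nlinarith
      linarith
    · intro x hx hxd
      have hx0 := hx.1
      simp only [le_min_iff] at hxd
      obtain ⟨⟨a1, a2⟩, a3, a4⟩ := hxd
      have b := (abs_le.1 (h0 x hx0 a1)).1
      rw [le_div_iff₀ (by positivity)] at a3
      have z1 : 0 < s * x := mul_pos hs0 hx0
      have z2 : s * x ≤ 1 := by linarith
      have c1 := Real.sin_gt_sub_cube z1
      have c2 := Real.sin_le_one (s * x)
      have c3 := Real.cos_le_one (s * x)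
      have c4 := hsin x hx
      have d1 : (1 / x - M * x) * Real.sin (s * x) ≤ h x * Real.sin (s * x) :=
        mul_le_mul_of_nonneg_right (by linarith) c4.le
      have d2 : M * x * Real.sin (s * x) ≤ M * x * 1 :=
        mul_le_mul_of_nonneg_left c2 (by positivity)
      have d3 : 1 / x * (s * x - (s * x) ^ 3 / 6) ≤ 1 / x * Real.sin (s * x) :=
        mul_le_mul_of_nonneg_left (by linarith) (by positivity)
      have d4 : 1 / x * (s * x - (s * x) ^ 3 / 6) = s - s ^ 2 * x * (s * x) / 6 := by
        field_simp
      have d5 : s ^ 2 * x * (s * x) ≤ s ^ 2 * x * 1 :=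
        mul_le_mul_of_nonneg_left z2 (by positivity)
      have d6 : s * Real.cos (s * x) ≤ s * 1 := mul_le_mul_of_nonneg_left c3 hs0.le
      have d7 : 0 < s ^ 2 * x := by positivity
      linarith
  intro x hx
  have h1 := key x hx
  have h2 := mul_nonneg hs0.le (hcos x hx)
  by_contra hn
  push Not at hn
  nlinarith [hsin x hx]

lemma ric_upper {H R : ℝ} {K h h' : ℝ → ℝ} (hH : 0 < H) (hHR : H * R ^ 2 ≤ Real.pi ^ 2 / 4)
    (hK : ∀ x ∈ Ioc (0:ℝ) R, |K x| ≤ H)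
    (hd : ∀ x ∈ Ioc (0:ℝ) R, HasDerivWithinAt h (h' x) (Ioc 0 R) x)
    (he : ∀ x ∈ Ioc (0:ℝ) R, h' x + h x ^ 2 + K x = 0)
    (h0 : ∃ M δ : ℝ, 0 < M ∧ 0 < δ ∧ ∀ x : ℝ, 0 < x → x ≤ δ → |h x - 1 / x| ≤ M * x) :
    ∀ x ∈ Ioc (0:ℝ) R, h x ≤ 4 / x ∧ |h' x| ≤ 19 / x ^ 2 := by
  have hpos := ric_pos hH hHR hK hd he h0
  obtain ⟨M, δ, hM, hδ, h0⟩ := h0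
  have key : ∀ x ∈ Ioc (0:ℝ) R, 0 ≤ x⁻¹ + H * x - h x := by
    apply ric_barrier (M := M) (δ := δ) (p := fun x => x⁻¹ + H * x + h x)
      (w' := fun x => -(x ^ 2)⁻¹ + H - h' x) hδ hM
    · apply ContinuousOn.add
      · apply ContinuousOn.add
        · exact continuousOn_inv₀.mono fun x hx => hx.1.ne'
        · fun_prop
      · exact fun x hx => (hd x hx).continuousWithinAt
    · intro x hx
      have e : HasDerivAt (fun x : ℝ => H * x) H x := by
        simpa using (hasDerivAt_id x).const_mul H
      exact (((hasDerivAt_inv hx.1.ne').add e).hasDerivWithinAt).sub (hd x hx)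
    · intro x hx
      have hx0 := hx.1
      have e1 : h' x = - h x ^ 2 - K x := by linarith [he x hx]
      have e2 := (abs_le.1 (hK x hx)).1
      have e3 : x⁻¹ * x = 1 := inv_mul_cancel₀ hx0.ne'
      have e4 : (x ^ 2)⁻¹ = x⁻¹ ^ 2 := (inv_pow x 2).symm
      rw [e1, e4]
      have : -x⁻¹ ^ 2 + H - (-h x ^ 2 - K x) + (x⁻¹ + H * x + h x) * (x⁻¹ + H * x - h x)
        = H + K x + 2 * H * (x⁻¹ * x) + (H * x) ^ 2 := by ring
      rw [this, e3]
      nlinarith [sq_nonneg (H * x)]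
    · intro x hx _
      have := hpos x hx
      have hx0 := hx.1
      positivity
    · intro x hx hxd
      have hx0 := hx.1
      have := (abs_le.1 (h0 x hx0 hxd)).2
      rw [one_div] at this
      have : 0 < H * x := by positivity
      linarith
  intro x hx
  have hx0 := hx.1
  have hHx : H * x ^ 2 ≤ 3 := by
    have a1 : x ^ 2 ≤ R ^ 2 := by
      have := hx.2
      gcongr
    have a2 : H * x ^ 2 ≤ H * R ^ 2 := mul_le_mul_of_nonneg_left a1 hH.le
    nlinarith [Real.pi_lt_d2, Real.pi_pos]
  have h1 : h x ≤ 4 / x := by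
    rw [le_div_iff₀ hx0]
    have := mul_le_mul_of_nonneg_right (sub_nonneg.1 (key x hx)) hx0.le
    rw [add_mul, inv_mul_cancel₀ hx0.ne'] at this
    linarith
  refine ⟨h1, ?_⟩
  have e1 : h' x = - h x ^ 2 - K x := by linarith [he x hx]
  have e2 := abs_le.1 (hK x hx)
  rw [le_div_iff₀ hx0] at h1
  rw [le_div_iff₀ (by positivity)]
  have h2 : (h x * x) ^ 2 ≤ 4 ^ 2 := by
    have := hpos x hx
    gcongr
  have h3 : |h' x| ≤ h x ^ 2 + H := by
    rw [e1, abs_le]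
    constructor <;> nlinarith [sq_nonneg (h x)]
  nlinarith [mul_le_mul_of_nonneg_right h3 (sq_nonneg x)]

lemma ric_diff {R T : ℝ} {K₁ K₂ h₁ h₂ h₁' h₂' : ℝ → ℝ} (hT : 0 < T)
    (hK : ∀ x ∈ Ioc (0:ℝ) R, |K₁ x - K₂ x| ≤ T)
    (hd₁ : ∀ x ∈ Ioc (0:ℝ) R, HasDerivWithinAt h₁ (h₁' x) (Ioc 0 R) x)
    (hd₂ : ∀ x ∈ Ioc (0:ℝ) R, HasDerivWithinAt h₂ (h₂' x) (Ioc 0 R) x)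
    (he₁ : ∀ x ∈ Ioc (0:ℝ) R, h₁' x + h₁ x ^ 2 + K₁ x = 0)
    (he₂ : ∀ x ∈ Ioc (0:ℝ) R, h₂' x + h₂ x ^ 2 + K₂ x = 0)
    (hp₁ : ∀ x ∈ Ioc (0:ℝ) R, 0 ≤ h₁ x) (hp₂ : ∀ x ∈ Ioc (0:ℝ) R, 0 ≤ h₂ x)
    (h01 : ∃ M δ : ℝ, 0 < M ∧ 0 < δ ∧ ∀ x : ℝ, 0 < x → x ≤ δ → |h₁ x - 1 / x| ≤ M * x)
    (h02 : ∃ M δ : ℝ, 0 < M ∧ 0 < δ ∧ ∀ x : ℝ, 0 < x → x ≤ δ → |h₂ x - 1 / x| ≤ M * x) :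
    ∀ x ∈ Ioc (0:ℝ) R, h₁ x - h₂ x ≤ T * x := by
  obtain ⟨M₁, δ₁, hM₁, hδ₁, h01⟩ := h01
  obtain ⟨M₂, δ₂, hM₂, hδ₂, h02⟩ := h02
  have key : ∀ x ∈ Ioc (0:ℝ) R, 0 ≤ T * x - (h₁ x - h₂ x) := by
    apply ric_barrier (M := M₁ + M₂) (δ := min δ₁ δ₂) (p := fun x => h₁ x + h₂ x)
      (w' := fun x => T - (h₁' x - h₂' x)) (lt_min hδ₁ hδ₂) (by positivity)
    · exact fun x hx => (hd₁ x hx).continuousWithinAt.add (hd₂ x hx).continuousWithinAt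
    · intro x hx
      have e : HasDerivAt (fun x : ℝ => T * x) T x := by
        simpa using (hasDerivAt_id x).const_mul T
      exact e.hasDerivWithinAt.sub ((hd₁ x hx).sub (hd₂ x hx))
    · intro x hx
      have e1 : h₁' x = - h₁ x ^ 2 - K₁ x := by linarith [he₁ x hx]
      have e2 : h₂' x = - h₂ x ^ 2 - K₂ x := by linarith [he₂ x hx]
      have e3 := (abs_le.1 (hK x hx)).1
      have e4 : 0 ≤ (h₁ x + h₂ x) * (T * x) :=
        mul_nonneg (add_nonneg (hp₁ x hx) (hp₂ x hx)) (mul_nonneg hT.le hx.1.le)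
      rw [e1, e2]
      linarith
    · exact fun x hx _ => add_nonneg (hp₁ x hx) (hp₂ x hx)
    · intro x hx hxd
      simp only [le_min_iff] at hxd
      have a := (abs_le.1 (h01 x hx.1 hxd.1)).2
      have b := (abs_le.1 (h02 x hx.1 hxd.2)).1
      have := mul_nonneg hT.le hx.1.le
      linarith
  intro x hx
  linarith [key x hx]


/-- Stability lemma for the Riccati equation (Lemma 2.10 of the paper). -/
theorem riccati_stability :
    ∃ C : ℝ, 0 < C ∧
      ∀ (H L R T α : ℝ) (K₁ K₂ h₁ h₂ h₁' h₂' : ℝ → ℝ),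
        0 < H → 0 < L → 0 < R → 0 < T → 0 < α → α ≤ 1 →
        H * R ^ 2 ≤ Real.pi ^ 2 / 4 →
        ContinuousOn K₁ (Ioc 0 R) → ContinuousOn K₂ (Ioc 0 R) →
        (∀ x ∈ Ioc (0:ℝ) R, |K₁ x| ≤ H) →
        (∀ x ∈ Ioc (0:ℝ) R, |K₂ x| ≤ H) →
        (∀ x ∈ Ioc (0:ℝ) R, ∀ y ∈ Ioc (0:ℝ) R, |K₁ x - K₁ y| ≤ L * |x - y| ^ α) →
        (∀ x ∈ Ioc (0:ℝ) R, ∀ y ∈ Ioc (0:ℝ) R, |K₂ x - K₂ y| ≤ L * |x - y| ^ α) →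
        (∀ x ∈ Ioc (0:ℝ) R, |K₁ x - K₂ x| ≤ T) →
        (∀ x ∈ Ioc (0:ℝ) R, HasDerivWithinAt h₁ (h₁' x) (Ioc 0 R) x) →
        (∀ x ∈ Ioc (0:ℝ) R, HasDerivWithinAt h₂ (h₂' x) (Ioc 0 R) x) →
        (∀ x ∈ Ioc (0:ℝ) R, h₁' x + h₁ x ^ 2 + K₁ x = 0) →
        (∀ x ∈ Ioc (0:ℝ) R, h₂' x + h₂ x ^ 2 + K₂ x = 0) →
        (∃ M δ : ℝ, 0 < M ∧ 0 < δ ∧ ∀ x : ℝ, 0 < x → x ≤ δ → |h₁ x - 1 / x| ≤ M * x) →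
        (∃ M δ : ℝ, 0 < M ∧ 0 < δ ∧ ∀ x : ℝ, 0 < x → x ≤ δ → |h₂ x - 1 / x| ≤ M * x) →
        ∀ r : ℝ, 0 < r → r ≤ R →
          (∀ x ∈ Icc r R, |h₁ x - h₂ x| ≤ C * T * R) ∧
          (∀ x ∈ Icc r R, |h₁' x - h₂' x| ≤ C * T) ∧
          (∀ x ∈ Icc r R, ∀ y ∈ Icc r R,
            |(h₁ x - h₂ x) - (h₁ y - h₂ y)| ≤ C * T * R ^ (1 - α) * |x - y| ^ α) ∧
          (∀ x ∈ Icc r R, ∀ y ∈ Icc r R,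
            |(h₁' x - h₂' x) - (h₁' y - h₂' y)| ≤
              C * (L + T * R ^ (-α) * (1 + R / r)) * |x - y| ^ α) := by
  refine ⟨110, by norm_num, ?_⟩
  intro H L R T α K₁ K₂ h₁ h₂ h₁' h₂' hH hL hR hT hα hα1 hHR _ _ hK₁ hK₂ hl₁ hl₂ hK hd₁ hd₂
    he₁ he₂ h01 h02 r hr hrR
  have hp₁ := ric_pos hH hHR hK₁ hd₁ he₁ h01
  have hp₂ := ric_pos hH hHR hK₂ hd₂ he₂ h02
  have hu₁ := ric_upper hH hHR hK₁ hd₁ he₁ h01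
  have hu₂ := ric_upper hH hHR hK₂ hd₂ he₂ h02
  have hf : ∀ x ∈ Ioc (0:ℝ) R, |h₁ x - h₂ x| ≤ T * x := by
    intro x hx
    have a := ric_diff hT hK hd₁ hd₂ he₁ he₂ hp₁ hp₂ h01 h02 x hx
    have b := ric_diff hT (fun x hx => by rw [abs_sub_comm]; exact hK x hx)
      hd₂ hd₁ he₂ he₁ hp₂ hp₁ h02 h01 x hx
    rw [abs_le]
    constructor <;> linarith
  have hsum : ∀ x ∈ Ioc (0:ℝ) R, |h₁ x + h₂ x| ≤ 8 / x := by
    intro x hx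
    rw [abs_of_nonneg (add_nonneg (hp₁ x hx) (hp₂ x hx))]
    have e : 8 / x = 4 / x + 4 / x := by ring
    linarith [(hu₁ x hx).1, (hu₂ x hx).1]
  have hfe : ∀ x ∈ Ioc (0:ℝ) R,
      h₁' x - h₂' x = -((h₁ x + h₂ x) * (h₁ x - h₂ x)) - (K₁ x - K₂ x) := by
    intro x hx
    linarith [he₁ x hx, he₂ x hx]
  have hf' : ∀ x ∈ Ioc (0:ℝ) R, |h₁' x - h₂' x| ≤ 9 * T := by
    intro x hx
    have hx0 := hx.1
    rw [hfe x hx]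
    have a : |(h₁ x + h₂ x) * (h₁ x - h₂ x)| ≤ 8 / x * (T * x) := by
      rw [abs_mul]
      exact mul_le_mul (hsum x hx) (hf x hx) (abs_nonneg _) (by positivity)
    have e : 8 / x * (T * x) = 8 * T := by field_simp
    rw [e, abs_le] at a
    have b := abs_le.1 (hK x hx)
    rw [abs_le]
    constructor <;> linarith
  have hsub : Icc r R ⊆ Ioc 0 R := fun x hx => ⟨hr.trans_le hx.1, hx.2⟩
  have hlip : ∀ x ∈ Icc r R, ∀ y ∈ Icc r R,
      |(h₁ x - h₂ x) - (h₁ y - h₂ y)| ≤ 9 * T * |x - y| := by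
    intro x hx y hy
    have := (convex_Icc r R).norm_image_sub_le_of_norm_hasDerivWithin_le
      (f := fun x => h₁ x - h₂ x) (f' := fun x => h₁' x - h₂' x) (C := 9 * T)
      (fun z hz => ((hd₁ z (hsub hz)).sub (hd₂ z (hsub hz))).mono hsub)
      (fun z hz => hf' z (hsub hz)) hy hx
    simpa [Real.norm_eq_abs] using this
  have hpow : ∀ x ∈ Icc r R, ∀ y ∈ Icc r R,
      |x - y| ≤ R ^ (1 - α) * |x - y| ^ α := by
    intro x hx y hy
    rcases eq_or_ne x y with rfl | hne
    · simp [Real.zero_rpow hα.ne']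
    have h0 : 0 < |x - y| := abs_pos.2 (sub_ne_zero.2 hne)
    have h1 : |x - y| ≤ R := by
      rw [abs_le]
      constructor <;> linarith [hx.1, hx.2, hy.1, hy.2]
    have h2 : |x - y| = |x - y| ^ (1 - α) * |x - y| ^ α := by
      rw [← Real.rpow_add h0]; simp
    have h3 : |x - y| ^ (1 - α) ≤ R ^ (1 - α) :=
      Real.rpow_le_rpow h0.le h1 (by linarith)
    calc |x - y| = |x - y| ^ (1 - α) * |x - y| ^ α := h2
      _ ≤ _ := mul_le_mul_of_nonneg_right h3 (by positivity)
  have hglip : ∀ x ∈ Icc r R, ∀ y ∈ Icc r R, y ≤ x →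
      |(h₁ x + h₂ x) * (h₁ x - h₂ x) - (h₁ y + h₂ y) * (h₁ y - h₂ y)| ≤
        110 * T / r * |x - y| := by
    intro x hx y hy hyx
    have hx0 : 0 < x := hr.trans_le hx.1
    have hy0 : 0 < y := hr.trans_le hy.1
    have hss : Icc y x ⊆ Ioc 0 R := fun z hz => ⟨hy0.trans_le hz.1, hz.2.trans hx.2⟩
    have hsl : |(h₁ x + h₂ x) - (h₁ y + h₂ y)| ≤ 38 / y ^ 2 * |x - y| := by
      have := (convex_Icc y x).norm_image_sub_le_of_norm_hasDerivWithin_le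
        (f := fun x => h₁ x + h₂ x) (f' := fun x => h₁' x + h₂' x) (C := 38 / y ^ 2)
        (fun z hz => ((hd₁ z (hss hz)).add (hd₂ z (hss hz))).mono hss)
        (fun z hz => by
          have a := (hu₁ z (hss hz)).2
          have b := (hu₂ z (hss hz)).2
          have c : 19 / z ^ 2 ≤ 19 / y ^ 2 := by
            have := hz.1
            gcongr
          have e : 38 / y ^ 2 = 19 / y ^ 2 + 19 / y ^ 2 := by ring
          have := abs_add_le (h₁' z) (h₂' z)
          rw [Real.norm_eq_abs]
          linarith) (left_mem_Icc.2 hyx) (right_mem_Icc.2 hyx)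
      simpa [Real.norm_eq_abs] using this
    have e : (h₁ x + h₂ x) * (h₁ x - h₂ x) - (h₁ y + h₂ y) * (h₁ y - h₂ y)
      = (h₁ x + h₂ x) * ((h₁ x - h₂ x) - (h₁ y - h₂ y))
        + ((h₁ x + h₂ x) - (h₁ y + h₂ y)) * (h₁ y - h₂ y) := by ring
    have t1 : |(h₁ x + h₂ x) * ((h₁ x - h₂ x) - (h₁ y - h₂ y))|
        ≤ 8 / r * (9 * T * |x - y|) := by
      rw [abs_mul]
      have c : 8 / x ≤ 8 / r := by
        have := hx.1
        gcongr
      exact mul_le_mul ((hsum x (hsub hx)).trans c) (hlip x hx y hy) (abs_nonneg _)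
        (by positivity)
    have t2 : |((h₁ x + h₂ x) - (h₁ y + h₂ y)) * (h₁ y - h₂ y)|
        ≤ 38 / r * (T * |x - y|) := by
      rw [abs_mul]
      calc _ ≤ (38 / y ^ 2 * |x - y|) * (T * y) :=
            mul_le_mul hsl (hf y (hsub hy)) (abs_nonneg _) (by positivity)
        _ = 38 / y * (T * |x - y|) := by field_simp
        _ ≤ _ := by
            have := hy.1
            gcongr
    rw [e]
    refine (abs_add_le _ _).trans ((add_le_add t1 t2).trans (le_of_eq ?_))
    ring
  refine ⟨?_, ?_, ?_, ?_⟩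
  · intro x hx
    have a := hf x (hsub hx)
    have b : T * x ≤ T * R := mul_le_mul_of_nonneg_left hx.2 hT.le
    have c : 0 < T * R := mul_pos hT hR
    linarith
  · intro x hx
    linarith [hf' x (hsub hx)]
  · intro x hx y hy
    have a := hlip x hx y hy
    have b := mul_le_mul_of_nonneg_left (hpow x hx y hy) hT.le
    have c : 0 ≤ T * (R ^ (1 - α) * |x - y| ^ α) := by positivity
    nlinarith
  · have main : ∀ x ∈ Icc r R, ∀ y ∈ Icc r R, y ≤ x →
      |(h₁' x - h₂' x) - (h₁' y - h₂' y)| ≤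
              110 * (L + T * R ^ (-α) * (1 + R / r)) * |x - y| ^ α := by
      intro x hx y hy hyx
      have a := hglip x hx y hy hyx
      have b := hpow x hx y hy
      have c : 110 * T / r * |x - y| ≤ 110 * T / r * (R ^ (1 - α) * |x - y| ^ α) :=
        mul_le_mul_of_nonneg_left b (by positivity)
      have d : R ^ (1 - α) = R ^ (-α) * R := by
        rw [sub_eq_add_neg, add_comm, Real.rpow_add hR, Real.rpow_one]
      have k1 := abs_le.1 (hl₁ x (hsub hx) y (hsub hy))
      have k2 := abs_le.1 (hl₂ x (hsub hx) y (hsub hy))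
      have ab := abs_le.1 (a.trans c)
      have e : 110 * (L + T * R ^ (-α) * (1 + R / r)) * |x - y| ^ α
        = 110 * (L * |x - y| ^ α) + 110 * (T * R ^ (-α) * |x - y| ^ α)
          + 110 * T / r * (R ^ (1 - α) * |x - y| ^ α) := by
        rw [d]; ring
      have p1 : 0 ≤ L * |x - y| ^ α := by positivity
      have p2 : 0 ≤ T * R ^ (-α) * |x - y| ^ α := by positivity
      rw [e, hfe x (hsub hx), hfe y (hsub hy), abs_le]
      constructor <;> linarith [ab.1, ab.2]
    intro x hx y hy
    rcases le_total y x with h | h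
    · exact main x hx y hy h
    · rw [abs_sub_comm, abs_sub_comm x y]
      exact main y hy x hx h
end

section
/- Let k ∈ ℕ, 0 < α ≤ 1 and L > 0, and let F be a real-valued function defined on an interval I ⊆ ℝ. Suppose that for every subset S ⊆ I consisting of at most k + 2 points there exists a function F_S ∈ C^{k,α}(ℝ) which agrees with F on S and satisfies ‖F_S^{(k)}‖_α ≤ L. Then F is C^{k,α} on I and ‖F^{(k)}‖_α ≤ C·L, where C is a constant depending on k alone. -/
open Set

/-- Divided difference of `f` over the finite set `S`. -/
noncomputable def dd (S : Finset ℝ) (f : ℝ → ℝ) : ℝ :=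
  ∑ x ∈ S, f x / ∏ y ∈ S.erase x, (x - y)

lemma dd_insert {S : Finset ℝ} {a : ℝ} (ha : a ∉ S) (f : ℝ → ℝ) :
    dd (insert a S) f = f a / ∏ y ∈ S, (a - y)
      + ∑ x ∈ S, f x / ((x - a) * ∏ y ∈ S.erase x, (x - y)) := by
  unfold dd
  rw [Finset.sum_insert ha, Finset.erase_insert ha]
  congr 1
  refine Finset.sum_congr rfl fun x hx => ?_
  have hne : x ≠ a := fun h => ha (h ▸ hx)
  rw [Finset.erase_insert_of_ne hne.symm, Finset.prod_insert]
  exact fun h => ha (Finset.mem_of_mem_erase h)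

lemma dd_insert2 {T : Finset ℝ} {x y : ℝ} (hx : x ∉ T) (hy : y ∉ T) (hxy : y ≠ x) (f : ℝ → ℝ) :
    dd (insert y (insert x T)) f = f y / ((y - x) * ∏ t ∈ T, (y - t))
      + f x / ((x - y) * ∏ t ∈ T, (x - t))
      + ∑ s ∈ T, f s / ((s - y) * ((s - x) * ∏ t ∈ T.erase s, (s - t))) := by
  have hy' : y ∉ insert x T := by simp [hxy, hy]
  rw [dd_insert hy', Finset.sum_insert hx, Finset.prod_insert hx, Finset.erase_insert hx, add_assoc]
  congr 2
  refine Finset.sum_congr rfl fun s hs => ?_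
  have hne : s ≠ x := fun h => hx (h ▸ hs)
  rw [Finset.erase_insert_of_ne hne.symm, Finset.prod_insert]
  exact fun h => hx (Finset.mem_of_mem_erase h)

lemma dd_sub {S : Finset ℝ} {a b : ℝ} (ha : a ∉ S) (hb : b ∉ S) (hab : a ≠ b) (f : ℝ → ℝ) :
    dd (insert a S) f - dd (insert b S) f = (a - b) * dd (insert a (insert b S)) f := by
  have hab' : a - b ≠ 0 := sub_ne_zero.2 hab
  have hba' : b - a ≠ 0 := sub_ne_zero.2 hab.symm
  have hpa : ∏ y ∈ S, (a - y) ≠ 0 :=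
    Finset.prod_ne_zero_iff.2 fun y hy => sub_ne_zero.2 fun h => ha (h ▸ hy)
  have hpb : ∏ y ∈ S, (b - y) ≠ 0 :=
    Finset.prod_ne_zero_iff.2 fun y hy => sub_ne_zero.2 fun h => hb (h ▸ hy)
  have key : ∑ x ∈ S, f x / ((x - a) * ∏ y ∈ S.erase x, (x - y))
      - ∑ x ∈ S, f x / ((x - b) * ∏ y ∈ S.erase x, (x - y))
      = (a - b) * ∑ s ∈ S, f s / ((s - a) * ((s - b) * ∏ t ∈ S.erase s, (s - t))) := by
    rw [Finset.mul_sum, ← Finset.sum_sub_distrib]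
    refine Finset.sum_congr rfl fun s hs => ?_
    have h1 : s - a ≠ 0 := sub_ne_zero.2 fun h => ha (h ▸ hs)
    have h2 : s - b ≠ 0 := sub_ne_zero.2 fun h => hb (h ▸ hs)
    have h3 : ∏ t ∈ S.erase s, (s - t) ≠ 0 :=
      Finset.prod_ne_zero_iff.2 fun y hy => sub_ne_zero.2 (Finset.ne_of_mem_erase hy).symm
    field_simp
    ring
  rw [dd_insert ha, dd_insert hb, dd_insert2 hb ha hab, mul_add, ← key]
  have e1 : (a - b) * (f a / ((a - b) * ∏ t ∈ S, (a - t)) + f b / ((b - a) * ∏ t ∈ S, (b - t)))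
      = f a / ∏ t ∈ S, (a - t) - f b / ∏ t ∈ S, (b - t) := by
    field_simp
    ring
  rw [e1]
  ring

lemma rolle_gen (k : ℕ) : ∀ (f : ℝ → ℝ), ContDiff ℝ k f → ∀ x : ℕ → ℝ,
    (∀ i < k, x i < x (i + 1)) → (∀ i ≤ k, f (x i) = 0) →
    ∃ ξ ∈ Icc (x 0) (x k), iteratedDeriv k f ξ = 0 := by
  induction k with
  | zero =>
    intro f _ x _ h
    exact ⟨x 0, by simp, by simpa using h 0 le_rfl⟩
  | succ k ih =>
    intro f hf x hx h
    have hd : ∀ i, ∃ y, i < k + 1 → (y ∈ Ioo (x i) (x (i + 1)) ∧ deriv f y = 0) := by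
      intro i
      by_cases hi : i < k + 1
      · obtain ⟨y, hy, hy'⟩ := exists_deriv_eq_zero (hx i hi) (hf.continuous.continuousOn)
          ((h i hi.le).trans (h (i + 1) hi).symm)
        exact ⟨y, fun _ => ⟨hy, hy'⟩⟩
      · exact ⟨0, fun h => absurd h hi⟩
    choose y hy using hd
    have hf' : ContDiff ℝ k (deriv f) := by
      have : ContDiff ℝ ((k : WithTop ℕ∞) + 1) f := by exact_mod_cast hf
      exact (contDiff_succ_iff_deriv.1 this).2.2
    obtain ⟨ξ, hξ, h0⟩ := ih (deriv f) hf' y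
      (fun i hi => (hy i (by omega)).1.2.trans (hy (i + 1) (by omega)).1.1)
      (fun i hi => (hy i (by omega)).2)
    refine ⟨ξ, ⟨(hy 0 (by omega)).1.1.le.trans hξ.1, hξ.2.trans (hy k (by omega)).1.2.le⟩, ?_⟩
    rw [iteratedDeriv_succ', h0]

lemma iteratedDeriv_poly (P : Polynomial ℝ) (k : ℕ) :
    iteratedDeriv k (fun x => P.eval x) = fun x => ((Polynomial.derivative)^[k] P).eval x := by
  induction k generalizing P with
  | zero => simp
  | succ k ih =>
    rw [iteratedDeriv_succ']
    have : deriv (fun x => P.eval x) = fun x => P.derivative.eval x := by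
      ext x; simp
    rw [this, ih]
    rfl

lemma dd_mvt (k : ℕ) (f : ℝ → ℝ) (hf : ContDiff ℝ k f) (S : Finset ℝ) (hS : S.card = k + 1)
    (a b : ℝ) (hab : ∀ x ∈ S, x ∈ Icc a b) :
    ∃ ξ ∈ Icc a b, dd S f = iteratedDeriv k f ξ / k.factorial := by
  have hinj : Set.InjOn (id : ℝ → ℝ) S := Function.injective_id.injOn
  set P := Lagrange.interpolate S id f with hP
  have hdeg : P.degree < S.card := Lagrange.degree_interpolate_lt _ hinj
  have hPe : ∀ x ∈ S, P.eval x = f x := fun x hx =>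
    Lagrange.eval_interpolate_at_node (v := id) f hinj hx
  have hdd : dd S f = P.coeff k := by
    have := Lagrange.coeff_eq_sum hinj hdeg
    rw [hS, Nat.add_sub_cancel] at this
    rw [this, dd]
    exact Finset.sum_congr rfl fun x hx => by simp [hPe x hx]
  let x : ℕ → ℝ := fun i => if h : i < k + 1 then S.orderEmbOfFin hS ⟨i, h⟩ else 0
  have hxS : ∀ i ≤ k, x i ∈ S := by
    intro i hi
    simp only [x, dif_pos (Nat.lt_succ_of_le hi)]
    exact Finset.orderEmbOfFin_mem _ _ _
  have hPc : ContDiff ℝ k (fun x => P.eval x) := by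
    simpa using P.contDiff_aeval (R := ℝ) (𝕜 := ℝ) k
  obtain ⟨ξ, hξ, h0⟩ := rolle_gen k (fun x => f x - P.eval x) (hf.sub hPc) x
    (by
      intro i hi
      simp only [x, dif_pos (show i < k + 1 by omega), dif_pos (show i + 1 < k + 1 by omega)]
      simp)
    (by intro i hi; simp [hPe _ (hxS i hi)])
  refine ⟨ξ, ⟨(hab _ (hxS 0 (by omega))).1.trans hξ.1, hξ.2.trans (hab _ (hxS k le_rfl)).2⟩, ?_⟩
  have h1 : iteratedDeriv k (fun x => f x - P.eval x) ξ
      = iteratedDeriv k f ξ - iteratedDeriv k (fun x => P.eval x) ξ :=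
    iteratedDeriv_fun_sub hf.contDiffAt hPc.contDiffAt
  rw [h1, iteratedDeriv_poly] at h0
  have hnd : P.natDegree ≤ k := by
    rw [hS] at hdeg
    exact Polynomial.natDegree_le_of_degree_le (Order.le_of_lt_succ (by exact_mod_cast hdeg))
  have h2 : ((Polynomial.derivative)^[k] P).eval ξ = k.factorial * P.coeff k := by
    have hz : ((Polynomial.derivative)^[k] P).natDegree = 0 := by
      have := Polynomial.natDegree_iterate_derivative P k
      omega
    rw [Polynomial.eq_C_of_natDegree_eq_zero hz, Polynomial.eval_C,
      Polynomial.coeff_iterate_derivative]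
    simp [Nat.descFactorial_self]
  rw [hdd]
  have : (k.factorial : ℝ) ≠ 0 := by positivity
  field_simp
  linarith

/-- Bound on divided differences of order `k + 1`. -/
def DDBound (I : Set ℝ) (α : ℝ) (k : ℕ) (M : ℝ) (F : ℝ → ℝ) : Prop :=
  ∀ S : Finset ℝ, ↑S ⊆ I → S.card = k + 2 → ∀ a ∈ S, ∀ b ∈ S, a ≠ b →
    |dd S F| * |a - b| ^ (1 - α) ≤ M

lemma dd_congr {S : Finset ℝ} {f g : ℝ → ℝ} (h : ∀ x ∈ S, f x = g x) : dd S f = dd S g :=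
  Finset.sum_congr rfl fun x hx => by rw [h x hx]

lemma ddBound_of_local (k : ℕ) (α L : ℝ) (I : Set ℝ) (F : ℝ → ℝ) (hα : 0 < α) (hα1 : α ≤ 1)
    (hL : 0 < L)
    (H : ∀ S : Finset ℝ, ↑S ⊆ I → S.card ≤ k + 2 →
          ∃ F_S : ℝ → ℝ, ContDiff ℝ k F_S ∧
            (∀ x ∈ S, F_S x = F x) ∧
            (∀ x y : ℝ, |iteratedDeriv k F_S x - iteratedDeriv k F_S y| ≤ L * |x - y| ^ α)) :
    DDBound I α k L F := by
  intro S hSI hS a ha b hb hab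
  obtain ⟨f, hf, hfF, hfL⟩ := H S hSI hS.le
  rw [← dd_congr hfF]
  have hne : S.Nonempty := ⟨a, ha⟩
  set p := S.min' hne with hp
  set q := S.max' hne with hq
  have hpS : p ∈ S := S.min'_mem hne
  have hqS : q ∈ S := S.max'_mem hne
  have hI : ∀ x ∈ S, x ∈ Icc p q := fun x hx => ⟨S.min'_le x hx, S.le_max' x hx⟩
  have hpq : p < q := by
    have h1 := hI a ha
    have h2 := hI b hb
    rcases lt_or_gt_of_ne hab with h | h
    · exact h1.1.trans_lt (h.trans_le h2.2)
    · exact h2.1.trans_lt (h.trans_le h1.2)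
  set U := (S.erase q).erase p with hU
  have hpU : p ∉ U := Finset.notMem_erase _ _
  have hqU : q ∉ U := fun h => Finset.notMem_erase q S (Finset.mem_of_mem_erase h)
  have hUp : insert p U = S.erase q :=
    Finset.insert_erase (Finset.mem_erase.2 ⟨hpq.ne, hpS⟩)
  have hUq : insert q (insert p U) = S := by rw [hUp, Finset.insert_erase hqS]
  have hcp : (insert p U).card = k + 1 := by
    rw [hUp, Finset.card_erase_of_mem hqS, hS]; rfl
  have hcq : (insert q U).card = k + 1 := by
    rw [Finset.card_insert_of_notMem hpU] at hcp
    rw [Finset.card_insert_of_notMem hqU, hcp]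
  have hsubp : ∀ x ∈ insert p U, x ∈ Icc p q := fun x hx =>
    hI x (hUq ▸ Finset.mem_insert_of_mem hx)
  have hsubq : ∀ x ∈ insert q U, x ∈ Icc p q := by
    intro x hx
    apply hI
    rw [← hUq]
    simp only [Finset.mem_insert] at hx ⊢
    tauto
  obtain ⟨ξ, hξ, e1⟩ := dd_mvt k f hf _ hcp p q hsubp
  obtain ⟨η, hη, e2⟩ := dd_mvt k f hf _ hcq p q hsubq
  have e3 := dd_sub hqU hpU hpq.ne' f
  rw [hUq, e1, e2, ← sub_div] at e3
  have hqp : 0 < q - p := sub_pos.2 hpq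
  have hk : (1 : ℝ) ≤ k.factorial := by exact_mod_cast Nat.one_le_iff_ne_zero.2 k.factorial_ne_zero
  have h4 : (q - p) * |dd S f| ≤ L * (q - p) ^ α := by
    have : (q - p) * |dd S f| = |iteratedDeriv k f η - iteratedDeriv k f ξ| / k.factorial := by
      rw [← abs_of_pos hqp, ← abs_mul, ← e3, abs_div]
      congr 1
      exact abs_of_pos (by linarith)
    rw [this]
    refine (div_le_self (abs_nonneg _) hk).trans ((hfL _ _).trans ?_)
    gcongr
    rw [abs_le]
    constructor <;> linarith [hξ.1, hξ.2, hη.1, hη.2]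
  have h5 : |dd S f| * (q - p) ^ (1 - α) ≤ L := by
    have hpos : 0 < (q - p) ^ α := Real.rpow_pos_of_pos hqp _
    have : (q - p) ^ (1 - α) * (q - p) ^ α = q - p := by
      rw [← Real.rpow_add hqp]; simp
    refine le_of_mul_le_mul_right ?_ hpos
    calc |dd S f| * (q - p) ^ (1 - α) * (q - p) ^ α
        = (q - p) * |dd S f| := by rw [mul_assoc, this, mul_comm]
      _ ≤ _ := h4
  refine le_trans ?_ h5
  have hle : |a - b| ≤ q - p := by
    have h1 := hI a ha
    have h2 := hI b hb
    rw [abs_le]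
    constructor <;> linarith [h1.1, h1.2, h2.1, h2.2]
  have : 0 ≤ 1 - α := by linarith
  gcongr

open Filter Topology

lemma hasDerivAt_W (T : Finset ℝ) (x : ℝ) (hx : x ∉ T) :
    HasDerivAt (fun y => (∏ t ∈ T, (y - t))⁻¹)
      (-((∏ t ∈ T, (x - t))⁻¹ * ∑ t ∈ T, (x - t)⁻¹)) x := by
  induction T using Finset.induction_on with
  | empty => simpa using hasDerivAt_const x (1 : ℝ)
  | insert a T ha ih =>
    have hxa : x - a ≠ 0 := sub_ne_zero.2 fun h => hx (by simp [h])
    have hxT : x ∉ T := fun h => hx (Finset.mem_insert_of_mem h)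
    have h1 : HasDerivAt (fun y : ℝ => (y - a)⁻¹) (-1 / (x - a) ^ 2) x :=
      ((hasDerivAt_id x).sub_const a).inv hxa
    have h2 := h1.mul (ih hxT)
    simp only [Finset.prod_insert ha, Finset.sum_insert ha, mul_inv]
    refine h2.congr_deriv ?_
    field_simp
    ring

/-- regular part of the divided difference -/
lemma dd_slope {T : Finset ℝ} {x y : ℝ} (hx : x ∉ T) (hy : y ∉ T) (hxy : y ≠ x) (f : ℝ → ℝ) :
    dd (insert y (insert x T)) f = slope (fun z => f z * (∏ t ∈ T, (z - t))⁻¹) x y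
      + ∑ s ∈ T, f s / ((s - y) * ((s - x) * ∏ t ∈ T.erase s, (s - t))) := by
  rw [dd_insert2 hx hy hxy]
  congr 1
  have h1 : y - x ≠ 0 := sub_ne_zero.2 hxy
  have h2 : x - y ≠ 0 := sub_ne_zero.2 hxy.symm
  have hpa : ∏ t ∈ T, (x - t) ≠ 0 :=
    Finset.prod_ne_zero_iff.2 fun y hy => sub_ne_zero.2 fun h => hx (h ▸ hy)
  have hpb : ∏ t ∈ T, (y - t) ≠ 0 :=
    Finset.prod_ne_zero_iff.2 fun z hz => sub_ne_zero.2 fun h => hy (h ▸ hz)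
  rw [slope_def_field]
  field_simp
  ring

lemma tendsto_rest (T : Finset ℝ) (x : ℝ) (hx : x ∉ T) (f : ℝ → ℝ) (l : Filter ℝ) (hl : l ≤ 𝓝 x) :
    Tendsto (fun y => ∑ s ∈ T, f s / ((s - y) * ((s - x) * ∏ t ∈ T.erase s, (s - t)))) l
      (𝓝 (∑ s ∈ T, f s / ((s - x) * ((s - x) * ∏ t ∈ T.erase s, (s - t))))) := by
  refine tendsto_finsetSum _ fun s hs => ?_
  have h1 : s - x ≠ 0 := sub_ne_zero.2 fun h => hx (h ▸ hs)
  have h3 : ∏ t ∈ T.erase s, (s - t) ≠ 0 :=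
    Finset.prod_ne_zero_iff.2 fun y hy => sub_ne_zero.2 (Finset.ne_of_mem_erase hy).symm
  have hid : Tendsto (fun y : ℝ => y) l (𝓝 x) := hl
  exact tendsto_const_nhds.div ((tendsto_const_nhds.sub hid).mul tendsto_const_nhds)
    (mul_ne_zero h1 (mul_ne_zero h1 h3))

lemma eventually_good (I : Set ℝ) (T : Finset ℝ) (x : ℝ) (hx : x ∉ T) :
    ∀ᶠ y in 𝓝[I \ {x}] x, y ∈ I ∧ y ≠ x ∧ y ∉ T := by
  have h1 : ∀ᶠ y in 𝓝[I \ {x}] x, y ∈ I \ {x} := eventually_mem_nhdsWithin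
  have h2 : ∀ᶠ y in 𝓝[I \ {x}] x, y ∉ T :=
    nhdsWithin_le_nhds (T.finite_toSet.isClosed.isOpen_compl.mem_nhds hx)
  filter_upwards [h1, h2] with y hy hy2
  exact ⟨hy.1, hy.2, hy2⟩

lemma tendsto_dd {I : Set ℝ} {T : Finset ℝ} {x : ℝ} (hx : x ∉ T) {f : ℝ → ℝ} {f' : ℝ}
    (hf : HasDerivWithinAt f f' I x) :
    Tendsto (fun y => dd (insert y (insert x T)) f) (𝓝[I \ {x}] x)
      (𝓝 (f' * (∏ t ∈ T, (x - t))⁻¹ + f x * (-((∏ t ∈ T, (x - t))⁻¹ * ∑ t ∈ T, (x - t)⁻¹))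
        + ∑ s ∈ T, f s / ((s - x) * ((s - x) * ∏ t ∈ T.erase s, (s - t))))) := by
  have h1 := hasDerivWithinAt_iff_tendsto_slope.1 (hf.mul (hasDerivAt_W T x hx).hasDerivWithinAt)
  refine (h1.add (tendsto_rest T x hx f _ nhdsWithin_le_nhds)).congr' ?_
  filter_upwards [eventually_good I T x hx] with y hy
  rw [dd_slope hx hy.2.2 hy.2.1]
  rfl

lemma sum_lim (S : Finset ℝ) (f f' : ℝ → ℝ) :
    ∑ x ∈ S, (f' x * (∏ t ∈ S.erase x, (x - t))⁻¹
        + f x * (-((∏ t ∈ S.erase x, (x - t))⁻¹ * ∑ t ∈ S.erase x, (x - t)⁻¹))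
        + ∑ s ∈ S.erase x, f s / ((s - x) * ((s - x) * ∏ t ∈ (S.erase x).erase s, (s - t))))
      = dd S f' := by
  have e : ∀ x ∈ S, (f' x * (∏ t ∈ S.erase x, (x - t))⁻¹
        + f x * (-((∏ t ∈ S.erase x, (x - t))⁻¹ * ∑ t ∈ S.erase x, (x - t)⁻¹))
        + ∑ s ∈ S.erase x, f s / ((s - x) * ((s - x) * ∏ t ∈ (S.erase x).erase s, (s - t))))
      = f' x / (∏ t ∈ S.erase x, (x - t))
        - ∑ t ∈ S, f x * (∏ t ∈ S.erase x, (x - t))⁻¹ * (x - t)⁻¹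
        + ∑ t ∈ S, f t * (∏ s ∈ S.erase t, (t - s))⁻¹ * (t - x)⁻¹ := by
    intro x hx
    have e1 : ∑ t ∈ S.erase x, (x - t)⁻¹ = ∑ t ∈ S, (x - t)⁻¹ :=
      Finset.sum_erase S (by simp)
    have e2 : ∑ s ∈ S.erase x, f s / ((s - x) * ((s - x) * ∏ t ∈ (S.erase x).erase s, (s - t)))
        = ∑ t ∈ S, f t * (∏ s ∈ S.erase t, (t - s))⁻¹ * (t - x)⁻¹ := by
      rw [← Finset.sum_erase S (a := x)
        (f := fun t => f t * (∏ s ∈ S.erase t, (t - s))⁻¹ * (t - x)⁻¹) (by simp)]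
      refine Finset.sum_congr rfl fun s hs => ?_
      have hsx : s ≠ x := Finset.ne_of_mem_erase hs
      have : ∏ t ∈ S.erase s, (s - t) = (s - x) * ∏ t ∈ (S.erase x).erase s, (s - t) := by
        rw [Finset.erase_right_comm]
        exact (Finset.mul_prod_erase _ _ (Finset.mem_erase.2 ⟨hsx.symm, hx⟩)).symm
      rw [← this, div_eq_mul_inv, mul_inv]
      ring
    rw [e1, e2, ← Finset.mul_sum]
    ring
  rw [Finset.sum_congr rfl e, Finset.sum_add_distrib, Finset.sum_sub_distrib]
  rw [Finset.sum_comm (f := fun x t => f t * (∏ s ∈ S.erase t, (t - s))⁻¹ * (t - x)⁻¹)]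
  rw [dd]
  ring

lemma ddBound_deriv {I : Set ℝ} {α M : ℝ} {n : ℕ} {F F' : ℝ → ℝ}
    (hne : ∀ x ∈ I, (𝓝[I \ {x}] x).NeBot)
    (hF : ∀ x ∈ I, HasDerivWithinAt F (F' x) I x) (H : DDBound I α (n + 1) M F) :
    DDBound I α n ((n + 2) * M) F' := by
  intro S hSI hS a ha b hb hab
  rw [← sum_lim S F F']
  have hc : ((n : ℝ) + 2) * M = ∑ x ∈ S, M := by
    rw [Finset.sum_const, hS]; simp
  rw [hc]
  refine (mul_le_mul_of_nonneg_right (Finset.abs_sum_le_sum_abs _ _)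
    (Real.rpow_nonneg (abs_nonneg _) _)).trans ?_
  rw [Finset.sum_mul]
  refine Finset.sum_le_sum fun x hx => ?_
  have hxI : x ∈ I := hSI hx
  have := hne x hxI
  have ht := tendsto_dd (Finset.notMem_erase x S) (hF x hxI)
  refine le_of_tendsto (ht.abs.mul_const _) ?_
  filter_upwards [eventually_good I (S.erase x) x (Finset.notMem_erase x S)] with y hy
  have hyS : y ∉ S := fun h => hy.2.2 (Finset.mem_erase.2 ⟨hy.2.1, h⟩)
  rw [Finset.insert_erase hx]
  refine H (insert y S) ?_ ?_ a (Finset.mem_insert_of_mem ha) b (Finset.mem_insert_of_mem hb) hab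
  · rw [Finset.coe_insert]
    exact Set.insert_subset hy.1 hSI
  · rw [Finset.card_insert_of_notMem hyS, hS]

lemma differentiable_of_ddBound {I : Set ℝ} {α M : ℝ} {n : ℕ} {F : ℝ → ℝ} (hα : 0 < α)
    (hinf : I.Infinite)
    (hne : ∀ x ∈ I, (𝓝[I \ {x}] x).NeBot) (H : DDBound I α (n + 1) M F) :
    DifferentiableOn ℝ F I := by
  intro x hxI
  have := hne x hxI
  obtain ⟨T, hTI, hT⟩ := (hinf.sdiff (Set.finite_singleton x)).exists_subset_card_eq n
  have hxT : x ∉ T := fun h => (hTI h).2 rfl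
  set g : ℝ → ℝ := fun y => dd (insert y (insert x T)) F with hg
  have hgd : ∀ y z, y ∈ I ∧ y ≠ x ∧ y ∉ T → z ∈ I ∧ z ≠ x ∧ z ∉ T → |g y - g z| ≤ M * |y - z| ^ α := by
    intro y z hy hz
    by_cases hyz : y = z
    · subst hyz
      simp [Real.zero_rpow hα.ne']
    have hy' : y ∉ insert x T := by simp [hy.2.1, hy.2.2]
    have hz' : z ∉ insert x T := by simp [hz.2.1, hz.2.2]
    rw [hg]
    simp only
    rw [dd_sub hy' hz' hyz, abs_mul]
    have hyz' : y ∉ insert z (insert x T) := by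
      rw [Finset.mem_insert]; tauto
    have hpos : 0 < |y - z| := abs_pos.2 (sub_ne_zero.2 hyz)
    have hb := H (insert y (insert z (insert x T))) (by
      simp only [Finset.coe_insert]
      exact Set.insert_subset hy.1 (Set.insert_subset hz.1
        (Set.insert_subset hxI fun t ht => (hTI ht).1)))
      (by rw [Finset.card_insert_of_notMem hyz', Finset.card_insert_of_notMem hz',
        Finset.card_insert_of_notMem hxT, hT]) y (by simp) z (by simp) hyz
    have e : |y - z| = |y - z| ^ (1 - α) * |y - z| ^ α := by
      rw [← Real.rpow_add hpos]; simp
    calc |y - z| * |dd (insert y (insert z (insert x T))) F|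
        = |dd (insert y (insert z (insert x T))) F| * |y - z| ^ (1 - α) * |y - z| ^ α := by
          rw [mul_assoc, ← e, mul_comm]
      _ ≤ _ := by gcongr
  have hcauchy : Cauchy (map g (𝓝[I \ {x}] x)) := by
    rw [Metric.cauchy_iff]
    refine ⟨inferInstance, fun ε hε => ?_⟩
    have hlim : Tendsto (fun p : ℝ × ℝ => M * |p.1 - p.2| ^ α)
        (𝓝[I \ {x}] x ×ˢ 𝓝[I \ {x}] x) (𝓝 0) := by
      have hc : Continuous (fun p : ℝ × ℝ => M * |p.1 - p.2| ^ α) := by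
        refine continuous_const.mul (Continuous.rpow_const (by fun_prop) fun _ => Or.inr hα.le)
      have h0 := hc.tendsto (x, x)
      simp only [sub_self, abs_zero, Real.zero_rpow hα.ne', mul_zero] at h0
      rw [nhds_prod_eq] at h0
      exact h0.mono_left (Filter.prod_mono nhdsWithin_le_nhds nhdsWithin_le_nhds)
    have hev := hlim.eventually (gt_mem_nhds hε)
    obtain ⟨s, hs, hs2⟩ := (Filter.eventually_prod_self_iff'.1 hev)
    have hgood := eventually_good I T x hxT
    refine ⟨g '' (s ∩ {y | y ∈ I ∧ y ≠ x ∧ y ∉ T}), image_mem_map (inter_mem hs hgood), ?_⟩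
    rintro _ ⟨y, hy, rfl⟩ _ ⟨z, hz, rfl⟩
    rw [Real.dist_eq]
    exact (hgd y z hy.2 hz.2).trans_lt (hs2 y hy.1 z hz.1)
  obtain ⟨c, hc⟩ := CompleteSpace.complete hcauchy
  have hW : HasDerivWithinAt (fun z => F z * (∏ t ∈ T, (z - t))⁻¹)
      (c - ∑ s ∈ T, F s / ((s - x) * ((s - x) * ∏ t ∈ T.erase s, (s - t)))) I x := by
    rw [hasDerivWithinAt_iff_tendsto_slope]
    have hc' : Tendsto g (𝓝[I \ {x}] x) (𝓝 c) := hc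
    refine (hc'.sub (tendsto_rest T x hxT F _ nhdsWithin_le_nhds)).congr' ?_
    filter_upwards [eventually_good I T x hxT] with y hy
    rw [hg]
    simp only
    rw [dd_slope hxT hy.2.2 hy.2.1]
    ring
  have hQ : DifferentiableWithinAt ℝ (fun z => ∏ t ∈ T, (z - t)) I x := by
    have : Differentiable ℝ (fun z : ℝ => ∏ t ∈ T, (z - t)) := by fun_prop
    exact this.differentiableAt.differentiableWithinAt
  have hcan : ∀ y, y ∉ T → F y = F y * (∏ t ∈ T, (y - t))⁻¹ * ∏ t ∈ T, (y - t) := by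
    intro y hy
    have hpb : ∏ t ∈ T, (y - t) ≠ 0 :=
      Finset.prod_ne_zero_iff.2 fun z hz => sub_ne_zero.2 fun h => hy (h ▸ hz)
    field_simp
  refine (hW.differentiableWithinAt.mul hQ).congr_of_eventuallyEq ?_ (hcan x hxT)
  have h2 : ∀ᶠ y in 𝓝[I] x, y ∉ T :=
    nhdsWithin_le_nhds (T.finite_toSet.isClosed.isOpen_compl.mem_nhds hxT)
  filter_upwards [h2] with y hy
  exact hcan y hy

lemma main_ind {I : Set ℝ} {α : ℝ} (hα : 0 < α) (hinf : I.Infinite) (hu : UniqueDiffOn ℝ I)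
    (hne : ∀ x ∈ I, (𝓝[I \ {x}] x).NeBot) (k : ℕ) : ∀ (F : ℝ → ℝ) (M : ℝ), DDBound I α k M F →
    ContDiffOn ℝ k F I ∧ ∀ x ∈ I, ∀ y ∈ I,
      |iteratedDerivWithin k F I x - iteratedDerivWithin k F I y| ≤
        (k + 1).factorial * M * |x - y| ^ α := by
  induction k with
  | zero =>
    intro F M H
    have h : ∀ x ∈ I, ∀ y ∈ I, |F x - F y| ≤ M * |x - y| ^ α := by
      intro x hx y hy
      by_cases hxy : x = y
      · subst hxy; simp [Real.zero_rpow hα.ne']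
      have hpos : 0 < |x - y| := abs_pos.2 (sub_ne_zero.2 hxy)
      have hb := H {x, y} (by simp [Set.insert_subset_iff, hx, hy]) (by simp [hxy])
        x (by simp) y (by simp) hxy
      have hd := dd_sub (S := ∅) (a := x) (b := y) (by simp) (by simp) hxy F
      simp only [insert_empty_eq] at hd
      have e0 : dd {x} F - dd {y} F = F x - F y := by simp [dd]
      rw [← e0, hd, abs_mul]
      have e : |x - y| = |x - y| ^ (1 - α) * |x - y| ^ α := by
        rw [← Real.rpow_add hpos]; simp
      calc |x - y| * |dd {x, y} F|
          = |dd {x, y} F| * |x - y| ^ (1 - α) * |x - y| ^ α := by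
            rw [mul_assoc, ← e, mul_comm]
        _ ≤ _ := by gcongr
    constructor
    · rw [Nat.cast_zero, contDiffOn_zero]
      intro x hx
      rw [ContinuousWithinAt, tendsto_iff_dist_tendsto_zero]
      have hlim : Tendsto (fun y : ℝ => M * |y - x| ^ α) (𝓝[I] x) (𝓝 0) := by
        have hc : Continuous (fun y : ℝ => M * |y - x| ^ α) := by
          refine continuous_const.mul (Continuous.rpow_const (by fun_prop) fun _ => Or.inr hα.le)
        have h0 := hc.tendsto x
        simp only [sub_self, abs_zero, Real.zero_rpow hα.ne', mul_zero] at h0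
        exact h0.mono_left nhdsWithin_le_nhds
      refine squeeze_zero' (Eventually.of_forall fun _ => dist_nonneg) ?_ hlim
      filter_upwards [self_mem_nhdsWithin] with y hy
      exact h y hy x hx
    · simpa using h
  | succ n ih =>
    intro F M H
    have hd := differentiable_of_ddBound hα hinf hne H
    have H' := ddBound_deriv hne (fun x hx => (hd x hx).hasDerivWithinAt) H
    obtain ⟨h1, h2⟩ := ih _ _ H'
    constructor
    · rw [Nat.cast_add, Nat.cast_one, contDiffOn_succ_iff_derivWithin hu]
      exact ⟨hd, fun h => absurd h (by simp), h1⟩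
    · intro x hx y hy
      rw [iteratedDerivWithin_succ']
      refine (h2 x hx y hy).trans (le_of_eq ?_)
      rw [Nat.factorial_succ (n + 1)]
      push_cast
      ring

/-- Finiteness principle for `C^{k,α}` functions on an interval
(Corollary 2.14 of the paper, after Whitney and Merrien). -/
theorem whitney_finiteness (k : ℕ) :
    ∃ C : ℝ, 0 < C ∧
      ∀ (α L : ℝ) (I : Set ℝ) (F : ℝ → ℝ),
        0 < α → α ≤ 1 → 0 < L → I.OrdConnected →
        (∀ S : Finset ℝ, ↑S ⊆ I → S.card ≤ k + 2 →
          ∃ F_S : ℝ → ℝ, ContDiff ℝ k F_S ∧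
            (∀ x ∈ S, F_S x = F x) ∧
            (∀ x y : ℝ, |iteratedDeriv k F_S x - iteratedDeriv k F_S y| ≤ L * |x - y| ^ α)) →
        ContDiffOn ℝ k F I ∧
        (∀ x ∈ I, ∀ y ∈ I,
          |iteratedDerivWithin k F I x - iteratedDerivWithin k F I y| ≤
            C * L * |x - y| ^ α) := by
  refine ⟨(k + 1).factorial, by positivity, ?_⟩
  intro α L I F hα hα1 hL hI H
  rcases I.subsingleton_or_nontrivial with hs | hnt
  · refine ⟨?_, fun x hx y hy => ?_⟩
    · rcases hs.eq_empty_or_singleton with h | ⟨a, h⟩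
      · rw [h]; exact contDiffOn_empty
      · rw [h]
        exact (contDiffOn_const (c := F a)).congr (by simp)
    · rw [hs hx hy]
      simp [Real.zero_rpow hα.ne']
  · have hB := ddBound_of_local k α L I F hα hα1 hL H
    have hconv : Convex ℝ I := hI.convex
    obtain ⟨a, ha, b, hb, hab⟩ := hnt.exists_lt
    have hinter : (interior I).Nonempty :=
      (Set.nonempty_Ioo.2 hab).mono
        (interior_maximal (Ioo_subset_Icc_self.trans (hI.out ha hb)) isOpen_Ioo)
    have hu : UniqueDiffOn ℝ I := uniqueDiffOn_convex hconv hinter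
    have hne : ∀ x ∈ I, (𝓝[I \ {x}] x).NeBot := fun x hx => by
      have := (hu x hx).accPt
      exact accPt_principal_iff_nhdsWithin.1 this
    have hinf : I.Infinite := (Set.Icc_infinite hab).mono (hI.out ha hb)
    exact main_ind hα hinf hu hne k F L hB
end

section
/- Let I ⊆ ℝ be an interval and let ρ : I → (0, ∞) be a C² function with |ρ′(t)| < 1 and 1/2 ≤ ρ(t)·ρ″(t)/(1 − ρ′(t)²) ≤ 2 for all t ∈ I. Define ω(t) := √(1 − ρ′(t)²)/ρ(t). Then for every subinterval J ⊆ I and all t₁, t₂ ∈ J: ω(t₁)/ω(t₂) ≤ (sup_J ρ / inf_J ρ)⁴. -/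
open Set

/-- On a compact piece of the interval there is a point maximizing `ω²` and minimizing `ω² ρ⁶`. -/
lemma exists_turning_point (ρ ρ' ρ'' : ℝ → ℝ) (a b : ℝ) (hab : a ≤ b)
    (hρpos : ∀ t ∈ Icc a b, 0 < ρ t)
    (hρ' : ∀ t ∈ Icc a b, HasDerivWithinAt ρ (ρ' t) (Icc a b) t)
    (hρ'' : ∀ t ∈ Icc a b, HasDerivWithinAt ρ' (ρ'' t) (Icc a b) t)
    (hlt : ∀ t ∈ Icc a b, 0 < 1 - ρ' t ^ 2)
    (h0 : ∀ t ∈ Icc a b, 0 ≤ ρ'' t)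
    (h2 : ∀ t ∈ Icc a b, ρ t * ρ'' t ≤ 2 * (1 - ρ' t ^ 2)) :
    ∃ t₀ ∈ Icc a b, ∀ t ∈ Icc a b,
      (1 - ρ' t ^ 2) / ρ t ^ 2 ≤ (1 - ρ' t₀ ^ 2) / ρ t₀ ^ 2 ∧
      (1 - ρ' t₀ ^ 2) * ρ t₀ ^ 4 ≤ (1 - ρ' t ^ 2) * ρ t ^ 4 := by
  have hc' : ContinuousOn ρ' (Icc a b) := fun t ht => (hρ'' t ht).continuousWithinAt
  have hmono : MonotoneOn ρ' (Icc a b) :=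
    monotoneOn_of_hasDerivWithinAt_nonneg (convex_Icc a b) hc'
      (fun t ht => (hρ'' t (interior_subset ht)).mono interior_subset)
      (fun t ht => h0 t (interior_subset ht))
  have key : ∃ t₀ ∈ Icc a b, (∀ t ∈ Ioo a t₀, ρ' t ≤ 0) ∧ (∀ t ∈ Ioo t₀ b, 0 ≤ ρ' t) := by
    have ha : a ∈ Icc a b := left_mem_Icc.2 hab
    have hb : b ∈ Icc a b := right_mem_Icc.2 hab
    rcases le_total 0 (ρ' a) with hA | hA
    · exact ⟨a, ha, fun t ht => absurd (ht.1.trans ht.2) (lt_irrefl a),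
        fun t ht => hA.trans (hmono ha (Ioo_subset_Icc_self ht) ht.1.le)⟩
    rcases le_total (ρ' b) 0 with hB | hB
    · exact ⟨b, hb, fun t ht => (hmono (Ioo_subset_Icc_self ht) hb ht.2.le).trans hB,
        fun t ht => absurd (ht.1.trans ht.2) (lt_irrefl b)⟩
    obtain ⟨t₀, ht₀, hz⟩ := intermediate_value_Icc hab hc' ⟨hA, hB⟩
    exact ⟨t₀, ht₀,
      fun t ht => hz ▸ hmono ⟨ht.1.le, ht.2.le.trans ht₀.2⟩ ht₀ ht.2.le,
      fun t ht => hz ▸ hmono ht₀ ⟨ht₀.1.trans ht.1.le, ht.2.le⟩ ht.1.le⟩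
  obtain ⟨t₀, ht₀, hneg, hpos⟩ := key
  have hG : ∀ t ∈ Icc a b, HasDerivWithinAt (fun t => (1 - ρ' t ^ 2) / ρ t ^ 2)
      (-ρ' t * (2 * (ρ t * ρ'' t + (1 - ρ' t ^ 2)) / ρ t ^ 3)) (Icc a b) t := by
    intro t ht
    have hr := hρpos t ht
    refine ((((hρ'' t ht).fun_pow 2).const_sub 1).fun_div ((hρ' t ht).fun_pow 2)
      (pow_pos hr 2).ne').congr_deriv ?_
    field_simp
    ring
  have hF : ∀ t ∈ Icc a b, HasDerivWithinAt (fun t => (1 - ρ' t ^ 2) * ρ t ^ 4)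
      (ρ' t * (2 * ρ t ^ 3 * (2 * (1 - ρ' t ^ 2) - ρ t * ρ'' t))) (Icc a b) t := by
    intro t ht
    refine ((((hρ'' t ht).fun_pow 2).const_sub 1).fun_mul ((hρ' t ht).fun_pow 4)).congr_deriv ?_
    push_cast
    ring
  have hGs : ∀ t ∈ Icc a b, 0 ≤ 2 * (ρ t * ρ'' t + (1 - ρ' t ^ 2)) / ρ t ^ 3 := by
    intro t ht
    have := hρpos t ht
    have := hlt t ht
    have := h0 t ht
    positivity
  have hFs : ∀ t ∈ Icc a b, 0 ≤ 2 * ρ t ^ 3 * (2 * (1 - ρ' t ^ 2) - ρ t * ρ'' t) := by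
    intro t ht
    have := hρpos t ht
    have := sub_nonneg.2 (h2 t ht)
    positivity
  have hsubL : Icc a t₀ ⊆ Icc a b := Icc_subset_Icc_right ht₀.2
  have hsubR : Icc t₀ b ⊆ Icc a b := Icc_subset_Icc_left ht₀.1
  have hGL : MonotoneOn (fun t => (1 - ρ' t ^ 2) / ρ t ^ 2) (Icc a t₀) := monotoneOn_of_hasDerivWithinAt_nonneg (convex_Icc a t₀)
    (fun t ht => ((hG t (hsubL ht)).mono hsubL).continuousWithinAt)
    (fun t ht => (hG t (hsubL (interior_subset ht))).mono (interior_subset.trans hsubL))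
    (fun t ht => mul_nonneg (neg_nonneg.2 (hneg t (by rwa [interior_Icc] at ht)))
      (hGs t (hsubL (interior_subset ht))))
  have hGR : AntitoneOn (fun t => (1 - ρ' t ^ 2) / ρ t ^ 2) (Icc t₀ b) := antitoneOn_of_hasDerivWithinAt_nonpos (convex_Icc t₀ b)
    (fun t ht => ((hG t (hsubR ht)).mono hsubR).continuousWithinAt)
    (fun t ht => (hG t (hsubR (interior_subset ht))).mono (interior_subset.trans hsubR))
    (fun t ht => mul_nonpos_of_nonpos_of_nonneg
      (neg_nonpos.2 (hpos t (by rwa [interior_Icc] at ht)))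
      (hGs t (hsubR (interior_subset ht))))
  have FL : AntitoneOn (fun t => (1 - ρ' t ^ 2) * ρ t ^ 4) (Icc a t₀) := antitoneOn_of_hasDerivWithinAt_nonpos (convex_Icc a t₀)
    (fun t ht => ((hF t (hsubL ht)).mono hsubL).continuousWithinAt)
    (fun t ht => (hF t (hsubL (interior_subset ht))).mono (interior_subset.trans hsubL))
    (fun t ht => mul_nonpos_of_nonpos_of_nonneg (hneg t (by rwa [interior_Icc] at ht))
      (hFs t (hsubL (interior_subset ht))))
  have FR : MonotoneOn (fun t => (1 - ρ' t ^ 2) * ρ t ^ 4) (Icc t₀ b) := monotoneOn_of_hasDerivWithinAt_nonneg (convex_Icc t₀ b)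
    (fun t ht => ((hF t (hsubR ht)).mono hsubR).continuousWithinAt)
    (fun t ht => (hF t (hsubR (interior_subset ht))).mono (interior_subset.trans hsubR))
    (fun t ht => mul_nonneg (hpos t (by rwa [interior_Icc] at ht))
      (hFs t (hsubR (interior_subset ht))))
  refine ⟨t₀, ht₀, fun t ht => ?_⟩
  rcases le_total t t₀ with h | h
  · exact ⟨hGL ⟨ht.1, h⟩ ⟨ht₀.1, le_rfl⟩ h, FL ⟨ht.1, h⟩ ⟨ht₀.1, le_rfl⟩ h⟩
  · exact ⟨hGR ⟨le_rfl, ht₀.2⟩ ⟨h, ht.2⟩ h, FR ⟨le_rfl, ht₀.2⟩ ⟨h, ht.2⟩ h⟩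

/-- Control on the variation of `ω = √(1-ρ'²)/ρ` (Lemma 4.2 of the paper). -/
theorem omega_variation (I : Set ℝ) (hI : I.OrdConnected)
    (ρ ρ' ρ'' : ℝ → ℝ)
    (hρpos : ∀ t ∈ I, 0 < ρ t)
    (hρ' : ∀ t ∈ I, HasDerivWithinAt ρ (ρ' t) I t)
    (hρ'' : ∀ t ∈ I, HasDerivWithinAt ρ' (ρ'' t) I t)
    (hρ''c : ContinuousOn ρ'' I)
    (hρ'lt : ∀ t ∈ I, |ρ' t| < 1)
    (hconv : ∀ t ∈ I, 1 / 2 ≤ ρ t * ρ'' t / (1 - ρ' t ^ 2) ∧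
      ρ t * ρ'' t / (1 - ρ' t ^ 2) ≤ 2) :
    ∀ J : Set ℝ, J ⊆ I → J.OrdConnected →
      ∀ t₁ ∈ J, ∀ t₂ ∈ J, ∀ m M : ℝ, 0 < m →
        (∀ t ∈ J, m ≤ ρ t ∧ ρ t ≤ M) →
        (Real.sqrt (1 - ρ' t₁ ^ 2) / ρ t₁) / (Real.sqrt (1 - ρ' t₂ ^ 2) / ρ t₂) ≤
          (M / m) ^ 4 := by
  intro J hJI hJ t₁ ht₁ t₂ ht₂ m M hm hmM
  have hsubJ : Icc (min t₁ t₂) (max t₁ t₂) ⊆ J := hJ.uIcc_subset ht₁ ht₂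
  have hsub := hsubJ.trans hJI
  have hlt : ∀ t ∈ I, 0 < 1 - ρ' t ^ 2 := fun t ht => by
    have := (sq_lt_one_iff_abs_lt_one (ρ' t)).2 (hρ'lt t ht)
    linarith
  obtain ⟨t₀, ht₀, H⟩ := exists_turning_point ρ ρ' ρ'' (min t₁ t₂) (max t₁ t₂) min_le_max
    (fun t ht => hρpos t (hsub ht)) (fun t ht => (hρ' t (hsub ht)).mono hsub)
    (fun t ht => (hρ'' t (hsub ht)).mono hsub) (fun t ht => hlt t (hsub ht))
    (fun t ht => by
      have h := (le_div_iff₀ (hlt t (hsub ht))).1 (hconv t (hsub ht)).1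
      have h1 := hlt t (hsub ht)
      have h2 := hρpos t (hsub ht)
      by_contra! hn
      nlinarith)
    (fun t ht => (div_le_iff₀ (hlt t (hsub ht))).1 (hconv t (hsub ht)).2)
  have h1 := (H t₁ ⟨min_le_left _ _, le_max_left _ _⟩).1
  have h2 := (H t₂ ⟨min_le_right _ _, le_max_right _ _⟩).2
  have r0 := hρpos t₀ (hsub ht₀)
  have r1 := hρpos t₁ (hJI ht₁)
  have r2 := hρpos t₂ (hJI ht₂)
  have x0 := hlt t₀ (hsub ht₀)
  have x1 := hlt t₁ (hJI ht₁)
  have x2 := hlt t₂ (hJI ht₂)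
  have b0 := (hmM t₀ (hsubJ ht₀)).1
  have b2 := (hmM t₂ ht₂).2
  have hMm : 1 ≤ M / m := (one_le_div hm).2 ((hmM t₂ ht₂).1.trans b2)
  have hq : ρ t₂ / ρ t₀ ≤ M / m := div_le_div₀ (r2.le.trans b2) b2 hm b0
  refine le_of_sq_le_sq ?_ (by positivity)
  have e : (Real.sqrt (1 - ρ' t₁ ^ 2) / ρ t₁ / (Real.sqrt (1 - ρ' t₂ ^ 2) / ρ t₂)) ^ 2
      = ((1 - ρ' t₁ ^ 2) / ρ t₁ ^ 2) * (ρ t₂ ^ 2 / (1 - ρ' t₂ ^ 2)) := by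
    rw [div_pow, div_pow, div_pow, Real.sq_sqrt x1.le, Real.sq_sqrt x2.le, div_div_eq_mul_div,
      mul_div_assoc]
  rw [e]
  calc ((1 - ρ' t₁ ^ 2) / ρ t₁ ^ 2) * (ρ t₂ ^ 2 / (1 - ρ' t₂ ^ 2))
      ≤ ((1 - ρ' t₀ ^ 2) / ρ t₀ ^ 2) * (ρ t₂ ^ 2 / (1 - ρ' t₂ ^ 2)) :=
        mul_le_mul_of_nonneg_right h1 (by positivity)
    _ = ((1 - ρ' t₀ ^ 2) * ρ t₀ ^ 4) * (ρ t₂ ^ 2 / (ρ t₀ ^ 6 * (1 - ρ' t₂ ^ 2))) := by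
        field_simp
    _ ≤ ((1 - ρ' t₂ ^ 2) * ρ t₂ ^ 4) * (ρ t₂ ^ 2 / (ρ t₀ ^ 6 * (1 - ρ' t₂ ^ 2))) :=
        mul_le_mul_of_nonneg_right h2 (by positivity)
    _ = (ρ t₂ / ρ t₀) ^ 6 := by
        field_simp
    _ ≤ (M / m) ^ 6 := pow_le_pow_left₀ (by positivity) hq 6
    _ ≤ (M / m) ^ 8 := pow_le_pow_right₀ hMm (by norm_num)
    _ = ((M / m) ^ 4) ^ 2 := by ring
end
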